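/- arXiv:2408.15014 — 8 statements merged into one kernel-verified Lean document; each statement's English description precedes it below -/
import Mathlib

section
/- Let α and β be types, φ : α → β → Prop a relation, and n, m ∈ ℕ with 1 ≤ n and 2n ≤ m. Let (a_1,…,a_m) be a φ-n-indiscernible sequence in α. Assume there exists b ∈ β such that the number of indices 1 ≤ i ≤ m−1 with φ(a_i, b) ≠ φ(a_{i+1}, b) is at least 2n−1. Then the sequence (a_1,…,a_n) is shattered by φ, i.e., for every subset S ⊆ {1,…,n} there exists b_S ∈ β such that φ(a_i, b_S) holds if and only if i ∈ S. -/
/-- The `φ`-`n`-type of a tuple `v : Fin n → α`: the collection of subsets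
`S ⊆ {0,…,n-1}` such that some `b : β` satisfies `φ (v i) b ↔ i ∈ S`. -/
def phiType {α β : Type*} (φ : α → β → Prop) {n : ℕ} (v : Fin n → α) : Set (Set (Fin n)) :=
  {S | ∃ b : β, ∀ i : Fin n, φ (v i) b ↔ i ∈ S}

/-- The sequence `a 0, …, a (m-1)` is `φ`-`n`-indiscernible: any two increasing
`n`-element subsequences have the same `φ`-`n`-type. -/
def IndiscSeq {α β : Type*} (φ : α → β → Prop) (n m : ℕ) (a : ℕ → α) : Prop :=
  ∀ u v : Fin n → ℕ, StrictMono u → StrictMono v → (∀ l, u l < m) → (∀ l, v l < m) →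
    phiType φ (fun l => a (u l)) = phiType φ (fun l => a (v l))

/-- The sequence `a 0, …, a (n-1)` is shattered by `φ`. -/
def ShatteredSeq {α β : Type*} (φ : α → β → Prop) (n : ℕ) (a : ℕ → α) : Prop :=
  ∀ S : Set ℕ, ∃ b : β, ∀ i < n, (φ (a i) b ↔ i ∈ S)

/-- If the truth value of `P` changes at least `2 * n - 1` times below `m`, then every pattern on
`Fin n` is realized by `P` along an increasing sequence of indices below `m`. -/
theorem exists_strictMono_iff_of_changes (P : ℕ → Prop) (n m : ℕ)
    (h : 2 * n - 1 ≤ {i : ℕ | i + 1 < m ∧ ¬ (P i ↔ P (i + 1))}.ncard) (S : Set (Fin n)) :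
    ∃ u : Fin n → ℕ, StrictMono u ∧ (∀ l, u l < m) ∧ ∀ l, P (u l) ↔ l ∈ S := by
  have hfin : {i : ℕ | i + 1 < m ∧ ¬ (P i ↔ P (i + 1))}.Finite :=
    (Set.finite_lt_nat m).subset fun i hi => (Nat.lt_succ_self i).trans hi.1
  rw [Set.ncard_eq_toFinset_card _ hfin] at h
  let d := Finset.orderEmbOfCardLe _ h
  have hd (k : Fin (2 * n - 1)) : d k + 1 < m ∧ ¬ (P (d k) ↔ P (d k + 1)) :=
    hfin.mem_toFinset.1 (Finset.orderEmbOfCardLe_mem _ h k)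
  let e : Fin n → ℕ := fun l => d ⟨2 * l, by omega⟩
  have he (l : Fin n) : e l + 1 < m ∧ ¬ (P (e l) ↔ P (e l + 1)) := hd _
  have hgap (l l' : Fin n) (hl : l < l') : e l + 1 < e l' := by
    have h₁ : d ⟨2 * l, by omega⟩ < d ⟨2 * l + 1, by omega⟩ :=
      d.strictMono (Fin.mk_lt_mk.2 (by omega))
    have h₂ : d ⟨2 * l + 1, by omega⟩ < d ⟨2 * l', by omega⟩ :=
      d.strictMono (Fin.mk_lt_mk.2 (by omega))
    exact lt_of_le_of_lt h₁ h₂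
  have hchoice (l : Fin n) : ∃ x, e l ≤ x ∧ x ≤ e l + 1 ∧ (P x ↔ l ∈ S) := by
    by_cases hx : P (e l) ↔ l ∈ S
    · exact ⟨e l, le_rfl, Nat.le_succ _, hx⟩
    · exact ⟨e l + 1, Nat.le_succ _, le_rfl, by have := (he l).2; tauto⟩
  choose u hlo hhi hP using hchoice
  exact ⟨u, fun l l' hl => (hhi l).trans_lt ((hgap l l' hl).trans_le (hlo l')),
    fun l => (hhi l).trans_lt (he l).1, hP⟩

theorem stmt0 {α β : Type*} (φ : α → β → Prop) (n m : ℕ) (hn : 1 ≤ n) (hm : 2 * n ≤ m)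
    (a : ℕ → α) (hind : IndiscSeq φ n m a) (b : β)
    (hb : 2 * n - 1 ≤ {i : ℕ | i + 1 < m ∧ ¬ (φ (a i) b ↔ φ (a (i + 1)) b)}.ncard) :
    ShatteredSeq φ n a := by
  intro S
  obtain ⟨u, hu, hum, huS⟩ :=
    exists_strictMono_iff_of_changes (fun i => φ (a i) b) n m hb {l | (l : ℕ) ∈ S}
  have hmem : {l : Fin n | (l : ℕ) ∈ S} ∈ phiType φ (fun l => a (u l)) := ⟨b, huS⟩
  rw [hind u (fun l => l) hu Fin.val_strictMono hum fun l => by omega] at hmem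
  obtain ⟨c, hc⟩ := hmem
  exact ⟨c, fun i hi => hc ⟨i, hi⟩⟩
end

section
/- Let α and β be types and φ : α → β → Prop a relation with VC dimension less than n (no sequence of length n in α is shattered by φ), where 1 ≤ n. Let m ∈ ℕ with 2n ≤ m and let (a_1,…,a_m) be a φ-n-indiscernible sequence in α. Then for every b ∈ β, the number of indices 1 ≤ i ≤ m−1 with φ(a_i, b) ≠ φ(a_{i+1}, b) is at most 2n−2. -/
/-- A finite set of naturals with at least `2 * n - 1` elements contains `n` elements, no two of
which are consecutive integers. -/
theorem exists_separated_of_le_card {A : Finset ℕ} {n : ℕ} (hA : 2 * n - 1 ≤ A.card) :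
    ∃ p : Fin n → ℕ, (∀ k, p k ∈ A) ∧ ∀ k l, k < l → p k + 1 < p l := by
  let g := Finset.orderEmbOfCardLe A hA
  refine ⟨fun k => g ⟨2 * k, by omega⟩, fun k => Finset.orderEmbOfCardLe_mem A hA _,
    fun k l hkl => ?_⟩
  have hkl' : (k : ℕ) < l := hkl
  have h₁ : g ⟨2 * k, by omega⟩ < g ⟨2 * k + 1, by omega⟩ :=
    g.strictMono (Fin.mk_lt_mk.2 (by omega))
  have h₂ : g ⟨2 * k + 1, by omega⟩ < g ⟨2 * l, by omega⟩ :=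
    g.strictMono (Fin.mk_lt_mk.2 (by omega))
  exact lt_of_le_of_lt h₁ h₂

/-- If the truth value of `P` changes between `p k` and `p k + 1` for each term of a separated
sequence `p`, then every pattern of truth values is realized along an increasing sequence. -/
theorem exists_strictMono_realizing {P : ℕ → Prop} {n : ℕ} {p : Fin n → ℕ}
    (hp : ∀ k l, k < l → p k + 1 < p l) (hP : ∀ k, ¬ (P (p k) ↔ P (p k + 1)))
    (S : Set (Fin n)) :
    ∃ u : Fin n → ℕ, StrictMono u ∧ (∀ k, u k ≤ p k + 1) ∧ ∀ k, P (u k) ↔ k ∈ S := by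
  have h : ∀ k, ∃ j, p k ≤ j ∧ j ≤ p k + 1 ∧ (P j ↔ k ∈ S) := fun k => by
    by_cases hk : P (p k) ↔ k ∈ S
    · exact ⟨p k, le_rfl, Nat.le_succ _, hk⟩
    · exact ⟨p k + 1, Nat.le_succ _, le_rfl, by have := hP k; tauto⟩
  choose u hu₁ hu₂ hu₃ using h
  exact ⟨u, fun k l hkl => (hu₂ k).trans_lt ((hp k l hkl).trans_le (hu₁ l)), hu₂, hu₃⟩

theorem stmt1 {α β : Type*} (φ : α → β → Prop) (n m : ℕ) (hn : 1 ≤ n)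
    (hVC : ∀ a : ℕ → α, ¬ ShatteredSeq φ n a) (hm : 2 * n ≤ m)
    (a : ℕ → α) (hind : IndiscSeq φ n m a) :
    ∀ b : β, {i : ℕ | i + 1 < m ∧ ¬ (φ (a i) b ↔ φ (a (i + 1)) b)}.ncard ≤ 2 * n - 2 := by
  intro b
  refine le_of_not_gt fun hlt => ?_
  set A : Set ℕ := {i : ℕ | i + 1 < m ∧ ¬ (φ (a i) b ↔ φ (a (i + 1)) b)}
  have hfin : A.Finite := (Set.finite_lt_nat m).subset fun i hi => (Nat.lt_succ_self i).trans hi.1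
  rw [Set.ncard_eq_toFinset_card A hfin] at hlt
  obtain ⟨p, hpA, hp⟩ := exists_separated_of_le_card (n := n) (A := hfin.toFinset) (by omega)
  simp only [Set.Finite.mem_toFinset] at hpA
  refine hVC a fun S => ?_
  obtain ⟨u, hu, hle, huS⟩ := exists_strictMono_realizing (P := fun i => φ (a i) b) hp
    (fun k => (hpA k).2) {k : Fin n | (k : ℕ) ∈ S}
  have hmem : {k : Fin n | (k : ℕ) ∈ S} ∈ phiType φ (fun l => a (u l)) := ⟨b, huS⟩
  rw [hind u Fin.val hu Fin.val_strictMono (fun l => (hle l).trans_lt (hpA l).1)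
    (fun l => by omega)] at hmem
  obtain ⟨c, hc⟩ := hmem
  exact ⟨c, fun i hi => hc ⟨i, hi⟩⟩
end

section
/- Let α and β be types and φ : α → β → Prop a relation. For all n, k, m ∈ ℕ with 1 ≤ n ≤ m, there exists N ∈ ℕ such that every (N,k)-array (a_{i,l}) (1 ≤ i ≤ N, 1 ≤ l ≤ k) of elements of α admits indices i_1 < … < i_m ≤ N for which the (m,k)-sub-array formed by rows i_1,…,i_m is φ-k-n-indiscernible. -/
/-- An `(m,k)`-array `a` (rows `i < m`, columns `l < k`) is `φ`-`k`-`n`-indiscernible: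
every column, viewed as a sequence of length `m`, is `φ`-`n`-indiscernible. -/
def ArrayIndisc {α β : Type*} (φ : α → β → Prop) (n k m : ℕ) (a : ℕ → ℕ → α) : Prop :=
  ∀ l < k, IndiscSeq φ n m (fun i => a i l)

/-- Finite sets of naturals that are large enough contain large subsets homogeneous for every
`C`-colouring of `n`-subsets. -/
def RamseyProperty (C : Type) (n : ℕ) : Prop :=
  ∀ m : ℕ, ∃ N : ℕ, ∀ (X : Finset ℕ) (c : Finset ℕ → C), N ≤ X.card →
    ∃ Y ⊆ X, Y.card = m ∧ ∃ d : C, ∀ s ⊆ Y, s.card = n → c s = d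

/-- From the Ramsey property for `n`-subsets one gets large sets on which the colour of an
`(n+1)`-subset depends only on its least element. -/
theorem RamseyProperty.exists_minHomogeneous {C : Type} [Nonempty C] {n : ℕ}
    (h : RamseyProperty C n) (t : ℕ) :
    ∃ N : ℕ, ∀ (X : Finset ℕ) (c : Finset ℕ → C), N ≤ X.card →
      ∃ Y ⊆ X, Y.card = t ∧ ∃ f : ℕ → C, ∀ x ∈ Y, ∀ s ⊆ Y, (∀ y ∈ s, x < y) → s.card = n →
        c (insert x s) = f x := by
  induction t with
  | zero =>
    exact ⟨0, fun X c _ => ⟨∅, by simp, by simp, fun _ => Classical.arbitrary C, by simp⟩⟩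
  | succ t ih =>
    obtain ⟨N₁, hN₁⟩ := ih
    obtain ⟨N₂, hN₂⟩ := h N₁
    refine ⟨N₂ + 1, fun X c hX => ?_⟩
    have hne : X.Nonempty := Finset.card_pos.mp (by omega)
    have hxX : X.min' hne ∈ X := X.min'_mem hne
    have hmin : ∀ y ∈ X, X.min' hne ≤ y := fun y hy => X.min'_le y hy
    generalize X.min' hne = x at hxX hmin
    obtain ⟨Z, hZX, hZ, d, hd⟩ := hN₂ (X.erase x) (fun s => c (insert x s))
      (by rw [Finset.card_erase_of_mem hxX]; omega)
    obtain ⟨Y, hYZ, hY, f, hf⟩ := hN₁ Z c hZ.ge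
    have hYX := hYZ.trans hZX
    have hxY : x ∉ Y := fun hx => Finset.notMem_erase x X (hYX hx)
    have hlt : ∀ y ∈ Y, x < y := fun y hy =>
      lt_of_le_of_ne (hmin y (Finset.mem_of_mem_erase (hYX hy))) fun e => hxY (e ▸ hy)
    refine ⟨insert x Y, ?_, by rw [Finset.card_insert_of_notMem hxY, hY],
      Function.update f x d, ?_⟩
    · exact Finset.insert_subset hxX (hYX.trans (Finset.erase_subset x X))
    intro z hz s hs hzs hcard
    have hxz : x ≤ z := by
      rcases Finset.mem_insert.mp hz with rfl | hz
      · exact le_rfl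
      · exact (hlt z hz).le
    have hsY : s ⊆ Y := fun y hy =>
      (Finset.mem_insert.mp (hs hy)).resolve_left (hxz.trans_lt (hzs y hy)).ne'
    rcases Finset.mem_insert.mp hz with rfl | hz
    · rw [Function.update_self]
      exact hd s (hsY.trans hYZ) hcard
    · rw [Function.update_of_ne (hlt z hz).ne']
      exact hf z hz s hsY hzs hcard

/-- The finite Ramsey theorem for `n`-uniform hypergraphs. -/
theorem ramseyProperty (C : Type) [Finite C] [Nonempty C] (n : ℕ) : RamseyProperty C n := by
  classical
  have := Fintype.ofFinite C
  induction n with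
  | zero =>
    intro m
    refine ⟨m, fun X c hX => ?_⟩
    obtain ⟨Y, hYX, hY⟩ := Finset.exists_subset_card_eq hX
    exact ⟨Y, hYX, hY, c ∅, fun s _ hs => by rw [Finset.card_eq_zero.mp hs]⟩
  | succ n ih =>
    intro m
    obtain ⟨N, hN⟩ := ih.exists_minHomogeneous (Fintype.card C * m)
    refine ⟨N, fun X c hX => ?_⟩
    obtain ⟨Z, hZX, hZ, f, hf⟩ := hN X c hX
    obtain ⟨d, -, hd⟩ := Finset.exists_le_card_fiber_of_mul_le_card_of_maps_to
      (s := Z) (t := Finset.univ) (f := f) (n := m) (fun _ _ => Finset.mem_univ _)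
      Finset.univ_nonempty (by rw [hZ, Finset.card_univ])
    obtain ⟨Y, hYZ, hY⟩ := Finset.exists_subset_card_eq hd
    have hsub := hYZ.trans (Finset.filter_subset _ Z)
    refine ⟨Y, hsub.trans hZX, hY, d, fun s hs hcard => ?_⟩
    have hne : s.Nonempty := Finset.card_pos.mp (by omega)
    have hx := s.min'_mem hne
    rw [← Finset.insert_erase hx, hf _ (hsub (hs hx)) _
      ((Finset.erase_subset _ s).trans (hs.trans hsub))
      (fun y hy => s.min'_lt_of_mem_erase_min' hne hy)
      (by rw [Finset.card_erase_of_mem hx]; omega)]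
    exact (Finset.mem_filter.mp (hYZ (hs hx))).2

theorem stmt2 {α β : Type*} (φ : α → β → Prop) (n k m : ℕ) (hn : 1 ≤ n) (hnm : n ≤ m) :
    ∃ N : ℕ, ∀ a : ℕ → ℕ → α, ∃ g : ℕ → ℕ,
      (∀ i j, i < j → j < m → g i < g j) ∧ (∀ i < m, g i < N) ∧
      ArrayIndisc φ n k m (fun i l => a (g i) l) := by
  classical
  obtain ⟨N, hN⟩ := ramseyProperty (Fin k → Set (Set (Fin n))) n m
  refine ⟨N, fun a => ?_⟩
  obtain ⟨Y, hYN, hY, d, hd⟩ := hN (Finset.range N)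
    (fun s => if h : s.card = n then fun l => phiType φ fun i => a (s.orderEmbOfFin h i) l
      else fun _ => ∅) (by simp)
  let g : ℕ → ℕ := fun i => if h : i < m then Y.orderEmbOfFin hY ⟨i, h⟩ else 0
  have hgY : ∀ i < m, g i ∈ Y := fun i hi => by
    simp only [g, dif_pos hi]
    exact Y.orderEmbOfFin_mem hY _
  have hg : ∀ i j, i < j → j < m → g i < g j := fun i j hij hj => by
    simp only [g, dif_pos hj, dif_pos (hij.trans hj)]
    exact (Y.orderEmbOfFin hY).strictMono hij
  have key : ∀ u : Fin n → ℕ, StrictMono u → (∀ i, u i < m) → ∀ l : Fin k,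
      phiType φ (fun i => a (g (u i)) l) = d l := by
    intro u hu hum l
    have hmono : StrictMono (fun i => g (u i)) := fun i j hij => hg _ _ (hu hij) (hum j)
    have hcard : (Finset.univ.image fun i => g (u i)).card = n := by
      rw [Finset.card_image_of_injective _ hmono.injective, Finset.card_univ, Fintype.card_fin]
    have hs := hd (Finset.univ.image fun i => g (u i))
      (Finset.image_subset_iff.mpr fun i _ => hgY _ (hum i)) hcard
    rw [dif_pos hcard, ← Finset.orderEmbOfFin_unique hcard
      (fun i => Finset.mem_image_of_mem _ (Finset.mem_univ i)) hmono] at hs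
    exact congrFun hs l
  refine ⟨g, hg, fun i hi => Finset.mem_range.mp (hYN (hgY i hi)), ?_⟩
  intro l hl u v hu hv hum hvm
  exact (key u hu hum ⟨l, hl⟩).trans (key v hv hvm ⟨l, hl⟩).symm
end

section
/- Let α and β be types, φ : α → β → ℝ a function taking values in [0,1], and 0 ≤ r < s ≤ 1 real numbers. For all n, k, m ∈ ℕ with 1 ≤ n ≤ m, there exists N ∈ ℕ such that every sequence (ā_1,…,ā_N) of k-tuples of elements of α admits a subsequence ā_{i_1},…,ā_{i_m} (i_1 < … < i_m) that is φ-k-n-A-indiscernible for r < s, i.e., all of its increasing n-element subsequences have the same φ-k-n-A-type. -/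
/-- `Ave(ā)(φ(·,b))` for a `k`-tuple `ā = (aa 0, …, aa (k-1))` of elements of `α`,
where `φ` is `[0,1]`-valued. -/
noncomputable def aveA {α β : Type*} (φ : α → β → ℝ) (k : ℕ) (aa : ℕ → α) (b : β) : ℝ :=
  (∑ j ∈ Finset.range k, φ (aa j) b) / k

/-- Part (i) of the `φ`-`k`-`n`-`A`-type of a tuple `v` of `k`-tuples: the subsets `S` for
which some `b : β` satisfies `Ave(v i)(φ(·,b)) ≤ r` for `i ∈ S` and `≥ s` for `i ∉ S`. -/
def CATypeWk {α β : Type*} (φ : α → β → ℝ) (k : ℕ) (r s : ℝ) {n : ℕ} (v : Fin n → ℕ → α) :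
    Set (Set (Fin n)) :=
  {S | ∃ b : β, (∀ i ∈ S, aveA φ k (v i) b ≤ r) ∧ ∀ i ∉ S, s ≤ aveA φ k (v i) b}

/-- Part (ii) of the `φ`-`k`-`n`-`A`-type of a tuple `v` of `k`-tuples: the subsets `S` for
which some `b : β` satisfies `Ave(v i)(φ(·,b)) > r` for `i ∈ S` and `< s` for `i ∉ S`. -/
def CATypeSt {α β : Type*} (φ : α → β → ℝ) (k : ℕ) (r s : ℝ) {n : ℕ} (v : Fin n → ℕ → α) :
    Set (Set (Fin n)) :=
  {S | ∃ b : β, (∀ i ∈ S, r < aveA φ k (v i) b) ∧ ∀ i ∉ S, aveA φ k (v i) b < s}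

/-- The sequence of `k`-tuples `a 0, …, a (m-1)` is `φ`-`k`-`n`-`A`-indiscernible for `r < s`:
all of its increasing `n`-element subsequences have the same `φ`-`k`-`n`-`A`-type. -/
def CAIndiscSeq {α β : Type*} (φ : α → β → ℝ) (n k m : ℕ) (r s : ℝ) (a : ℕ → ℕ → α) : Prop :=
  ∀ u v : Fin n → ℕ, StrictMono u → StrictMono v → (∀ l, u l < m) → (∀ l, v l < m) →
    CATypeWk φ k r s (fun l => a (u l)) = CATypeWk φ k r s (fun l => a (v l)) ∧
    CATypeSt φ k r s (fun l => a (u l)) = CATypeSt φ k r s (fun l => a (v l))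

/-- One step of the Erdős–Rado argument: if Ramsey's theorem holds for `n`-element sets, then every
large set has a subset of size `m` on which the colour of an `(n+1)`-element set depends
only on its minimum. -/
theorem exists_min_determined_subset {K : Type*} [Nonempty K] (n : ℕ)
    (ih : ∀ m : ℕ, ∃ N : ℕ, ∀ X : Finset ℕ, N ≤ X.card → ∀ c : Finset ℕ → K,
      ∃ Y ⊆ X, Y.card = m ∧ ∃ κ, ∀ t ⊆ Y, t.card = n → c t = κ) (m : ℕ) :
    ∃ N : ℕ, ∀ X : Finset ℕ, N ≤ X.card → ∀ c : Finset ℕ → K,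
      ∃ Y ⊆ X, Y.card = m ∧ ∃ d : ℕ → K, ∀ y ∈ Y, ∀ t ⊆ Y, t.card = n →
        (∀ z ∈ t, y < z) → c (insert y t) = d y := by
  induction m with
  | zero =>
    refine ⟨0, fun X _ c => ⟨∅, by simp, by simp, fun _ => Classical.arbitrary K, by simp⟩⟩
  | succ m ihm =>
    obtain ⟨M, hM⟩ := ihm
    obtain ⟨N, hN⟩ := ih M
    refine ⟨N + 1, fun X hX c => ?_⟩
    have hne : X.Nonempty := Finset.card_pos.mp (by omega)
    set x := X.min' hne with hx
    have hxX : x ∈ X := X.min'_mem hne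
    obtain ⟨Z, hZX, hZc, κ, hκ⟩ := hN (X.erase x)
      (by rw [Finset.card_erase_of_mem hxX]; omega) (fun t => c (insert x t))
    obtain ⟨Y, hYZ, hYc, d, hd⟩ := hM Z hZc.ge c
    have hlt : ∀ y ∈ Y, x < y := fun y hy => by
      have hy' := Finset.mem_erase.mp (hZX (hYZ hy))
      exact lt_of_le_of_ne (X.min'_le y hy'.2) hy'.1.symm
    have hxY : x ∉ Y := fun h => lt_irrefl _ (hlt x h)
    refine ⟨insert x Y, ?_, by rw [Finset.card_insert_of_notMem hxY, hYc],
      Function.update d x κ, ?_⟩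
    · exact Finset.insert_subset hxX
        ((hYZ.trans hZX).trans (Finset.erase_subset _ _))
    · intro y hy t ht htc hyt
      have hxy : x ≤ y := by
        rcases Finset.mem_insert.mp hy with h | h
        · exact h.ge
        · exact (hlt y h).le
      have htY : t ⊆ Y := fun z hz =>
        (Finset.mem_insert.mp (ht hz)).resolve_left (hxy.trans_lt (hyt z hz)).ne'
      rcases Finset.mem_insert.mp hy with h | h
      · rw [h, Function.update_self]
        exact hκ t (htY.trans hYZ) htc
      · rw [Function.update_of_ne (hlt y h).ne']
        exact hd y h t htY htc hyt

/-- Finite Ramsey theorem for `n`-element subsets and finitely many colours. -/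
theorem exists_homogeneous_subset {K : Type*} [Finite K] [Nonempty K] (n m : ℕ) :
    ∃ N : ℕ, ∀ X : Finset ℕ, N ≤ X.card → ∀ c : Finset ℕ → K,
      ∃ Y ⊆ X, Y.card = m ∧ ∃ κ, ∀ t ⊆ Y, t.card = n → c t = κ := by
  classical
  have := Fintype.ofFinite K
  induction n generalizing m with
  | zero =>
    refine ⟨m, fun X hX c => ?_⟩
    obtain ⟨Y, hYX, hY⟩ := Finset.exists_subset_card_eq hX
    exact ⟨Y, hYX, hY, c ∅, fun t _ ht => by rw [Finset.card_eq_zero.mp ht]⟩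
  | succ n ih =>
    obtain ⟨N, hN⟩ := exists_min_determined_subset (K := K) n ih (Fintype.card K * m)
    refine ⟨N, fun X hX c => ?_⟩
    obtain ⟨Z, hZX, hZc, d, hd⟩ := hN X hX c
    obtain ⟨κ, -, hκ⟩ := Finset.exists_le_card_fiber_of_mul_le_card_of_maps_to
      (s := Z) (t := Finset.univ) (f := d) (n := m) (fun _ _ => Finset.mem_univ _)
      Finset.univ_nonempty (by rw [hZc, Finset.card_univ])
    obtain ⟨Y, hY, hYc⟩ := Finset.exists_subset_card_eq hκ
    have hYZ : Y ⊆ Z := hY.trans (Finset.filter_subset _ _)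
    refine ⟨Y, hYZ.trans hZX, hYc, κ, fun t ht htc => ?_⟩
    have hne : t.Nonempty := Finset.card_pos.mp (by omega)
    have hmem := t.min'_mem hne
    rw [← Finset.insert_erase hmem, hd _ (hYZ (ht hmem)) (t.erase (t.min' hne))
      ((Finset.erase_subset _ _).trans (ht.trans hYZ))
      (by rw [Finset.card_erase_of_mem hmem, htc]; rfl)
      (fun z hz => t.min'_lt_of_mem_erase_min' hne hz)]
    exact (Finset.mem_filter.mp (hY (ht hmem))).2

theorem stmt5 {α β : Type*} (φ : α → β → ℝ) (hφ : ∀ a b, φ a b ∈ Set.Icc (0 : ℝ) 1)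
    (r s : ℝ) (hr : 0 ≤ r) (hrs : r < s) (hs : s ≤ 1)
    (n k m : ℕ) (hn : 1 ≤ n) (hnm : n ≤ m) :
    ∃ N : ℕ, ∀ a : ℕ → ℕ → α, ∃ g : ℕ → ℕ,
      (∀ i j, i < j → j < m → g i < g j) ∧ (∀ i < m, g i < N) ∧
      CAIndiscSeq φ n k m r s (fun i => a (g i)) := by
  classical
  obtain ⟨N, hN⟩ := exists_homogeneous_subset (K := Set (Set (Fin n)) × Set (Set (Fin n))) n m
  refine ⟨N, fun a => ?_⟩
  obtain ⟨Y, hYN, hYc, κ, hκ⟩ := hN (Finset.range N) (by simp) (fun t =>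
    if h : t.card = n then
      (CATypeWk φ k r s (fun l => a (t.orderEmbOfFin h l)),
        CATypeSt φ k r s (fun l => a (t.orderEmbOfFin h l)))
    else (∅, ∅))
  set g : ℕ → ℕ := fun i => if h : i < m then Y.orderEmbOfFin hYc ⟨i, h⟩ else 0 with hg
  have hgY : ∀ i < m, g i ∈ Y := fun i hi => by
    simp only [hg, dif_pos hi]
    exact Y.orderEmbOfFin_mem hYc _
  have hgmono : ∀ i j, i < j → j < m → g i < g j := fun i j hij hj => by
    simp only [hg, dif_pos hj, dif_pos (hij.trans hj)]
    exact (Y.orderEmbOfFin hYc).strictMono hij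
  have key : ∀ u : Fin n → ℕ, StrictMono u → (∀ l, u l < m) →
      (CATypeWk φ k r s (fun l => a (g (u l))), CATypeSt φ k r s (fun l => a (g (u l)))) = κ := by
    intro u hu hum
    have hmono : StrictMono (fun l => g (u l)) := fun i j hij => hgmono _ _ (hu hij) (hum j)
    have hcard : (Finset.univ.image (fun l => g (u l))).card = n := by
      rw [Finset.card_image_of_injective _ hmono.injective, Finset.card_univ, Fintype.card_fin]
    have h := hκ (Finset.univ.image (fun l => g (u l)))
      (Finset.image_subset_iff.mpr fun l _ => hgY _ (hum l)) hcard
    have he : (fun l => g (u l)) =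
        (Finset.univ.image (fun l => g (u l))).orderEmbOfFin hcard :=
      Finset.orderEmbOfFin_unique hcard
        (fun l => Finset.mem_image_of_mem _ (Finset.mem_univ l)) hmono
    rw [dif_pos hcard, ← he] at h
    exact h
  refine ⟨g, hgmono, fun i hi => Finset.mem_range.mp (hYN (hgY i hi)), ?_⟩
  intro u v hu hv hum hvm
  exact Prod.mk.inj ((key u hu hum).trans (key v hv hvm).symm)
end

section
/- Let α and β be types and φ : α → β → Prop a relation with VC dimension less than n (no sequence of length n in α is shattered by φ), where 1 ≤ n. Let k, m, t ∈ ℕ with k, t ≥ 1 and 2n ≤ m, and let (a_{i,h}) (1 ≤ i ≤ m, 1 ≤ h ≤ k) be an (m,k)-array of elements of α each of whose columns (a_{1,h},…,a_{m,h}) is φ-n-indiscernible. Write ā_i = (a_{i,1},…,a_{i,k}) for the i-th row. Then for all b_1,…,b_t ∈ β: Σ_{l=1}^{m−1} | (1/t)·Σ_{j=1}^t Ave(ā_{l+1})(φ(·,b_j)) − (1/t)·Σ_{j=1}^t Ave(ā_l)(φ(·,b_j)) | ≤ 2n−2. -/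
/-- `Ave(ā)(φ(·,b))` for the `k`-tuple `ā = (aa 0, …, aa (k-1))`:
the fraction of indices `h < k` with `φ (aa h) b`. -/
noncomputable def ave {α β : Type*} (φ : α → β → Prop) (k : ℕ) (aa : ℕ → α) (b : β) : ℝ :=
  ({h : ℕ | h < k ∧ φ (aa h) b}.ncard : ℝ) / k

open Classical in
/-- If the predicate `p` changes value at least `2 * n - 1` times along `0, …, m - 1`, then every
truth pattern of length `n` is realized along an increasing `n`-element subsequence. -/
lemma exists_strictMono_pattern_of_changes (p : ℕ → Prop) (n m : ℕ)
    (h : 2 * n - 1 ≤ {l ∈ Finset.range (m - 1) | ¬(p (l + 1) ↔ p l)}.card) (S : Set (Fin n)) :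
    ∃ u : Fin n → ℕ, StrictMono u ∧ (∀ i, u i < m) ∧ ∀ i, p (u i) ↔ i ∈ S := by
  let c := Finset.orderEmbOfCardLe _ h
  have hc (i) : c i < m - 1 ∧ ¬(p (c i + 1) ↔ p (c i)) := by
    simpa using Finset.orderEmbOfCardLe_mem _ h i
  let d : Fin n → ℕ := fun i => c ⟨2 * i, by omega⟩
  have hd (i j : Fin n) (hij : i < j) : d i + 1 < d j := by
    have h₁ : d i < c ⟨2 * i + 1, by omega⟩ := c.strictMono (by simp [Fin.lt_def])
    have h₂ : c ⟨2 * i + 1, by omega⟩ < d j :=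
      c.strictMono (by simp only [Fin.lt_def] at hij ⊢; omega)
    omega
  refine ⟨fun i => if p (d i) ↔ i ∈ S then d i else d i + 1, fun i j hij => ?_, fun i => ?_,
    fun i => ?_⟩
  · have := hd i j hij
    dsimp only
    split_ifs <;> omega
  · have : d i < m - 1 := (hc _).1
    dsimp only
    split_ifs <;> omega
  · have : ¬(p (d i + 1) ↔ p (d i)) := (hc _).2
    dsimp only
    split_ifs <;> tauto

open Classical in
/-- Along an indiscernible sequence, an instance of a relation of VC dimension less than `n`
changes its truth value at most `2 * n - 2` times. -/
lemma IndiscSeq.card_changes_le {α β : Type*} {φ : α → β → Prop} {n m : ℕ} (hn : 1 ≤ n)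
    (hVC : ∀ a : ℕ → α, ¬ ShatteredSeq φ n a) (hm : n ≤ m) {a : ℕ → α}
    (ha : IndiscSeq φ n m a) (b : β) :
    {l ∈ Finset.range (m - 1) | ¬(φ (a (l + 1)) b ↔ φ (a l) b)}.card ≤ 2 * n - 2 := by
  by_contra hlt
  refine hVC a fun S => ?_
  obtain ⟨u, hu, hum, huS⟩ := exists_strictMono_pattern_of_changes (fun l => φ (a l) b) n m
    (by omega) {i : Fin n | (i : ℕ) ∈ S}
  have hmem : {i : Fin n | (i : ℕ) ∈ S} ∈ phiType φ (fun l => a (u l)) := ⟨b, huS⟩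
  rw [ha u (fun i => i) hu Fin.val_strictMono hum (fun i => i.2.trans_le hm)] at hmem
  obtain ⟨b', hb'⟩ := hmem
  exact ⟨b', fun i hi => hb' ⟨i, hi⟩⟩

open Classical in
lemma ave_eq_sum_div {α β : Type*} (φ : α → β → Prop) (k : ℕ) (aa : ℕ → α) (b : β) :
    ave φ k aa b = (∑ h ∈ Finset.range k, if φ (aa h) b then (1 : ℝ) else 0) / k := by
  have : {h : ℕ | h < k ∧ φ (aa h) b} = ↑{h ∈ Finset.range k | φ (aa h) b} := by
    ext; simp
  rw [ave, this, Set.ncard_coe_finset, Finset.sum_boole]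

open Classical in
lemma abs_ave_sub_ave_le {α β : Type*} (φ : α → β → Prop) (k : ℕ) (aa aa' : ℕ → α) (b : β) :
    |ave φ k aa b - ave φ k aa' b| ≤
      (∑ h ∈ Finset.range k, if ¬(φ (aa h) b ↔ φ (aa' h) b) then (1 : ℝ) else 0) / k := by
  rw [ave_eq_sum_div, ave_eq_sum_div, ← sub_div, ← Finset.sum_sub_distrib, abs_div, Nat.abs_cast]
  gcongr
  refine (Finset.abs_sum_le_sum_abs _ _).trans (Finset.sum_le_sum fun h _ => ?_)
  by_cases h₁ : φ (aa h) b <;> by_cases h₂ : φ (aa' h) b <;> simp [h₁, h₂]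

/-- The total variation of the averages of a single instance along the rows of an array with
indiscernible columns. -/
lemma sum_abs_ave_sub_ave_le {α β : Type*} {φ : α → β → Prop} {n k m : ℕ} (hn : 1 ≤ n)
    (hVC : ∀ a : ℕ → α, ¬ ShatteredSeq φ n a) (hm : n ≤ m)
    {a : ℕ → ℕ → α} (hcol : ∀ h < k, IndiscSeq φ n m (fun i => a i h)) (b : β) :
    ∑ l ∈ Finset.range (m - 1), |ave φ k (a (l + 1)) b - ave φ k (a l) b| ≤ 2 * (n : ℝ) - 2 := by
  classical
  have hn' : (0 : ℝ) ≤ 2 * n - 2 := by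
    have : (1 : ℝ) ≤ n := by exact_mod_cast hn
    linarith
  refine (Finset.sum_le_sum fun l _ => abs_ave_sub_ave_le φ k _ _ b).trans ?_
  rw [← Finset.sum_div, Finset.sum_comm]
  refine div_le_of_le_mul₀ k.cast_nonneg hn' ?_
  calc _ ≤ ∑ _h ∈ Finset.range k, (2 * (n : ℝ) - 2) := by
        refine Finset.sum_le_sum fun h hh => ?_
        have := (hcol h (Finset.mem_range.1 hh)).card_changes_le hn hVC hm b
        rw [Finset.sum_boole]
        calc _ ≤ ((2 * n - 2 : ℕ) : ℝ) := by exact_mod_cast this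
          _ = 2 * (n : ℝ) - 2 := by push_cast [show 2 ≤ 2 * n by omega]; ring
    _ = (2 * (n : ℝ) - 2) * k := by rw [Finset.sum_const, Finset.card_range, nsmul_eq_mul, mul_comm]

theorem stmt8 {α β : Type*} (φ : α → β → Prop) (n : ℕ) (hn : 1 ≤ n)
    (hVC : ∀ a : ℕ → α, ¬ ShatteredSeq φ n a)
    (k m t : ℕ) (hk : 1 ≤ k) (ht : 1 ≤ t) (hm : 2 * n ≤ m)
    (a : ℕ → ℕ → α) (hcol : ∀ h < k, IndiscSeq φ n m (fun i => a i h)) :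
    ∀ b : ℕ → β,
      ∑ l ∈ Finset.range (m - 1),
        |(∑ j ∈ Finset.range t, ave φ k (a (l + 1)) (b j)) / t -
          (∑ j ∈ Finset.range t, ave φ k (a l) (b j)) / t| ≤ 2 * (n : ℝ) - 2 := by
  intro b
  have hn' : (0 : ℝ) ≤ 2 * n - 2 := by
    have : (1 : ℝ) ≤ n := by exact_mod_cast hn
    linarith
  calc _ ≤ ∑ l ∈ Finset.range (m - 1),
        (∑ j ∈ Finset.range t, |ave φ k (a (l + 1)) (b j) - ave φ k (a l) (b j)|) / t := by
        refine Finset.sum_le_sum fun l _ => ?_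
        rw [← sub_div, ← Finset.sum_sub_distrib, abs_div, Nat.abs_cast]
        gcongr
        exact Finset.abs_sum_le_sum_abs _ _
    _ ≤ 2 * (n : ℝ) - 2 := by
        rw [← Finset.sum_div, Finset.sum_comm]
        refine div_le_of_le_mul₀ t.cast_nonneg hn' ?_
        refine (Finset.sum_le_sum fun j _ =>
          sum_abs_ave_sub_ave_le hn hVC (show n ≤ m by omega) hcol (b j)).trans_eq ?_
        rw [Finset.sum_const, Finset.card_range, nsmul_eq_mul, mul_comm]
end

section
/- Let α and β be types and φ : α → β → Prop a relation with VC dimension less than n (no sequence of length n in α is shattered by φ). Then for every k ∈ ℕ with k ≥ 1 and all real numbers 0 ≤ r < s ≤ 1, there exists N ∈ ℕ such that no sequence (ā_1,…,ā_N) of k-tuples of elements of α is shattered by averages of elements of β for φ and r < s. -/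
/-- The tuples `ā_0, …, ā_{N-1}` (where `ā_i = (a i 0, …, a i (k i - 1))` has length `k i`)
are shattered by averages of elements of `β` for `φ` and `r < s`. -/
def ShatteredByAvg {α β : Type*} (φ : α → β → Prop) (r s : ℝ) (N : ℕ)
    (k : ℕ → ℕ) (a : ℕ → ℕ → α) : Prop :=
  ∀ S : Set ℕ, ∃ t : ℕ, 1 ≤ t ∧ ∃ b : ℕ → β, ∀ i < N,
    (i ∈ S → (∑ j ∈ Finset.range t, ave φ (k i) (a i) (b j)) / t ≤ r) ∧
    (i ∉ S → s ≤ (∑ j ∈ Finset.range t, ave φ (k i) (a i) (b j)) / t)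

open Classical in
/-- The family of traces on `X` of the sets `{i | φ (x i) b}`. -/
noncomputable def traceFamily {α β ι : Type*} (φ : α → β → Prop) (x : ι → α) (X : Finset ι) :
    Finset (Finset ι) :=
  X.powerset.filter fun A => ∃ b, A = X.filter fun i => φ (x i) b

open Classical in
theorem card_lt_of_shatters_traceFamily {α β ι : Type*} {φ : α → β → Prop} {n : ℕ} (hn : 1 ≤ n)
    (hVC : ∀ a : ℕ → α, ¬ ShatteredSeq φ n a) (x : ι → α) {X T : Finset ι}
    (hT : (traceFamily φ x X).Shatters T) : T.card < n := by
  by_contra! hcard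
  obtain ⟨U, hUT, hU⟩ := Finset.exists_subset_card_eq hcard
  have hSU := hT.mono_right hUT
  have hUX : U ⊆ X := by
    obtain ⟨A, hA, hUA⟩ := hSU (Finset.Subset.refl U)
    exact (Finset.inter_eq_left.1 hUA).trans (Finset.mem_powerset.1 (Finset.mem_filter.1 hA).1)
  let e : Fin n ≃ U := (U.equivFinOfCardEq hU).symm
  refine hVC (fun i => if h : i < n then x (e ⟨i, h⟩) else x (e ⟨0, hn⟩)) fun S => ?_
  obtain ⟨A, hA, hAS⟩ := hSU (t := U.filter fun u => ∃ i : Fin n, (i : ℕ) ∈ S ∧ (e i : ι) = u)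
    (Finset.filter_subset _ _)
  obtain ⟨-, b, rfl⟩ := Finset.mem_filter.1 hA
  refine ⟨b, fun i hi => ?_⟩
  have hmem := Finset.ext_iff.1 hAS (e ⟨i, hi⟩)
  have hU' := (e ⟨i, hi⟩).2
  have hX' := hUX hU'
  simp only [Finset.mem_inter, Finset.mem_filter, hU', hX', true_and] at hmem
  simp only [hi, dif_pos]
  rw [hmem]
  constructor
  · rintro ⟨j, hj, hji⟩
    have := e.injective (Subtype.ext hji)
    subst this
    exact hj
  · exact fun h => ⟨⟨i, hi⟩, h, rfl⟩

/-- A polynomial form of the Sauer–Shelah bound. -/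
theorem card_traceFamily_le {α β ι : Type*} {φ : α → β → Prop} {n : ℕ} (hn : 1 ≤ n)
    (hVC : ∀ a : ℕ → α, ¬ ShatteredSeq φ n a) (x : ι → α) (X : Finset ι) :
    (traceFamily φ x X).card ≤ n * (X.card + 1) ^ n := by
  classical
  have hsub : (traceFamily φ x X).shatterer ⊆
      (Finset.range n).biUnion fun j => X.powersetCard j := by
    intro T hT
    rw [Finset.mem_shatterer] at hT
    obtain ⟨A, hA, hTA⟩ := hT (Finset.Subset.refl T)
    have hTX : T ⊆ X :=
      (Finset.inter_eq_left.1 hTA).trans (Finset.mem_powerset.1 (Finset.mem_filter.1 hA).1)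
    simp only [Finset.mem_biUnion, Finset.mem_range, Finset.mem_powersetCard]
    exact ⟨T.card, card_lt_of_shatters_traceFamily hn hVC x hT, hTX, rfl⟩
  calc (traceFamily φ x X).card ≤ (traceFamily φ x X).shatterer.card :=
        Finset.card_le_card_shatterer _
    _ ≤ ∑ j ∈ Finset.range n, (X.powersetCard j).card :=
        (Finset.card_le_card hsub).trans Finset.card_biUnion_le
    _ ≤ ∑ _j ∈ Finset.range n, (X.card + 1) ^ n := by
        refine Finset.sum_le_sum fun j hj => ?_
        rw [Finset.card_powersetCard]
        calc X.card.choose j ≤ X.card ^ j := Nat.choose_le_pow _ _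
          _ ≤ (X.card + 1) ^ j := Nat.pow_le_pow_left (Nat.le_succ _) _
          _ ≤ (X.card + 1) ^ n := Nat.pow_le_pow_right (Nat.succ_pos _) (Finset.mem_range.1 hj).le
    _ = n * (X.card + 1) ^ n := by simp

/-- The sum of `± v i`, with sign `-` exactly on `S`. -/
noncomputable def signedSum {ι : Type*} [DecidableEq ι] (I S : Finset ι) (v : ι → ℝ) : ℝ :=
  ∑ i ∈ I, (if i ∈ S then -1 else 1) * v i

/-- The exponential moment bound for Rademacher sums. -/
theorem sum_exp_signedSum_le {ι : Type*} [DecidableEq ι] (I : Finset ι) (v : ι → ℝ)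
    (hv : ∀ i ∈ I, |v i| ≤ 1) (l : ℝ) :
    ∑ S ∈ I.powerset, Real.exp (l * signedSum I S v) ≤
      2 ^ I.card * Real.exp (l ^ 2 / 2) ^ I.card := by
  have hexp : ∀ S ∈ I.powerset, Real.exp (l * signedSum I S v) =
      (∏ i ∈ S, Real.exp (-(l * v i))) * ∏ i ∈ I \ S, Real.exp (l * v i) := by
    intro S hS
    rw [Finset.mem_powerset] at hS
    rw [← Real.exp_sum, ← Real.exp_sum, ← Real.exp_add, signedSum, ← Finset.sum_sdiff hS, mul_add,
      Finset.mul_sum, Finset.mul_sum, add_comm]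
    congr 2
    · exact Finset.sum_congr rfl fun i hi => by simp [hi]
    · exact Finset.sum_congr rfl fun i hi => by simp [(Finset.mem_sdiff.1 hi).2]
  rw [Finset.sum_congr rfl hexp, ← Finset.prod_add, ← mul_pow, ← Finset.prod_const]
  refine Finset.prod_le_prod (fun i _ => by positivity) fun i hi => ?_
  have hcosh := Real.cosh_le_exp_half_sq (l * v i)
  rw [Real.cosh_eq] at hcosh
  have hsq : (l * v i) ^ 2 / 2 ≤ l ^ 2 / 2 := by
    have := (sq_le_one_iff_abs_le_one _).2 (hv i hi)
    nlinarith [sq_nonneg l]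
  linarith [Real.exp_le_exp.2 hsq]

/-- A finite family of vectors in `[-1, 1]^I` that correlates well with every sign pattern is
exponentially large. -/
theorem exp_pow_le_card_of_signedSum_ge {ι κ : Type*} [DecidableEq ι] (I : Finset ι)
    (F : Finset κ) (v : κ → ι → ℝ) (hv : ∀ A ∈ F, ∀ i ∈ I, |v A i| ≤ 1) {c : ℝ} (hc : 0 ≤ c)
    (h : ∀ S ⊆ I, ∃ A ∈ F, I.card * c ≤ signedSum I S (v A)) :
    Real.exp (c ^ 2 / 2) ^ I.card ≤ F.card := by
  have hlow : ∀ S ∈ I.powerset, (Real.exp (c ^ 2 / 2) ^ I.card) ^ 2 ≤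
      ∑ A ∈ F, Real.exp (c * signedSum I S (v A)) := by
    intro S hS
    obtain ⟨A, hA, hSA⟩ := h S (Finset.mem_powerset.1 hS)
    refine le_trans ?_ (Finset.single_le_sum (f := fun A => Real.exp (c * signedSum I S (v A)))
      (fun _ _ => (Real.exp_pos _).le) hA)
    rw [← Real.exp_nat_mul, ← Real.exp_nat_mul]
    refine Real.exp_le_exp.2 ?_
    push_cast
    nlinarith [mul_le_mul_of_nonneg_left hSA hc]
  have hsum := Finset.sum_le_sum hlow
  rw [Finset.sum_const, Finset.card_powerset, Finset.sum_comm, nsmul_eq_mul] at hsum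
  have hup := Finset.sum_le_sum fun A hA => sum_exp_signedSum_le I (v A) (hv A hA) c
  rw [Finset.sum_const, nsmul_eq_mul] at hup
  have hpos : (0 : ℝ) < 2 ^ I.card * Real.exp (c ^ 2 / 2) ^ I.card := by positivity
  refine le_of_mul_le_mul_left ?_ hpos
  push_cast at hsum
  linarith [hsum.trans hup]

theorem ave_nonneg {α β : Type*} (φ : α → β → Prop) (k : ℕ) (aa : ℕ → α) (b : β) :
    0 ≤ ave φ k aa b := by
  unfold ave
  positivity

theorem ave_le_one {α β : Type*} (φ : α → β → Prop) (k : ℕ) (aa : ℕ → α) (b : β) :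
    ave φ k aa b ≤ 1 := by
  unfold ave
  refine div_le_one_of_le₀ ?_ (Nat.cast_nonneg _)
  have : {h : ℕ | h < k ∧ φ (aa h) b}.ncard ≤ (Finset.range k : Set ℕ).ncard :=
    Set.ncard_le_ncard (fun h hh => by simpa using hh.1) (Finset.finite_toSet _)
  rw [Set.ncard_coe_finset, Finset.card_range] at this
  exact_mod_cast this

/-- Averages over `b`'s shattering the tuples yield, for each sign pattern, a single `b`
correlating well with it. -/
theorem exists_signedSum_ge_of_shatteredByAvg {α β : Type*} {φ : α → β → Prop} {r s : ℝ} {N k : ℕ}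
    {a : ℕ → ℕ → α} (h : ShatteredByAvg φ r s N (fun _ => k) a) (S : Finset ℕ) :
    ∃ b, N * ((s - r) / 2) ≤
      signedSum (Finset.range N) S fun i => ave φ k (a i) b - (r + s) / 2 := by
  obtain ⟨t, ht, b, hb⟩ := h S
  have ht' : (0 : ℝ) < t := by exact_mod_cast ht
  have hsum : ∑ _j ∈ Finset.range t, N * ((s - r) / 2) ≤ ∑ j ∈ Finset.range t,
      signedSum (Finset.range N) S fun i => ave φ k (a i) (b j) - (r + s) / 2 := by
    unfold signedSum
    rw [Finset.sum_comm]
    calc ∑ _j ∈ Finset.range t, (N : ℝ) * ((s - r) / 2)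
        = ∑ _i ∈ Finset.range N, t * ((s - r) / 2) := by simp; ring
      _ ≤ _ := by
        refine Finset.sum_le_sum fun i hi => ?_
        obtain ⟨h1, h2⟩ := hb i (Finset.mem_range.1 hi)
        rw [← Finset.mul_sum, Finset.sum_sub_distrib, Finset.sum_const, Finset.card_range,
          nsmul_eq_mul]
        split_ifs with hiS
        · have := (div_le_iff₀ ht').1 (h1 hiS)
          linarith
        · have := (le_div_iff₀ ht').1 (h2 hiS)
          linarith
  obtain ⟨j, -, hj⟩ := Finset.exists_le_of_sum_le (Finset.nonempty_range_iff.2 (by omega)) hsum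
  exact ⟨b j, hj⟩

theorem exists_mul_pow_lt_pow (n k : ℕ) {q : ℝ} (hq : 1 < q) :
    ∃ N : ℕ, (n * (N * k + 1) ^ n : ℝ) < q ^ N := by
  have hlit := (isLittleO_pow_const_const_pow_of_one_lt (R := ℝ) n hq).def
    (c := 1 / (n * (k + 1) ^ n + 1)) (by positivity)
  obtain ⟨N, hN, hN1⟩ := (hlit.and (Filter.eventually_ge_atTop 1)).exists
  refine ⟨N, ?_⟩
  have hq0 : 0 < q ^ N := by positivity
  rw [Real.norm_of_nonneg (by positivity), Real.norm_of_nonneg hq0.le, one_div_mul_eq_div,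
    le_div_iff₀ (by positivity)] at hN
  have hN1' : (1 : ℝ) ≤ N := by exact_mod_cast hN1
  calc (n * (N * k + 1) ^ n : ℝ) ≤ n * (N * (k + 1)) ^ n := by
        gcongr
        linarith
    _ = N ^ n * (n * (k + 1) ^ n) := by rw [mul_pow]; ring
    _ < N ^ n * (n * (k + 1) ^ n + 1) := by
        have : (0 : ℝ) < N ^ n := by positivity
        nlinarith
    _ ≤ q ^ N := hN

theorem stmt9 {α β : Type*} (φ : α → β → Prop) (n : ℕ) (hn : 1 ≤ n)
    (hVC : ∀ a : ℕ → α, ¬ ShatteredSeq φ n a)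
    (k : ℕ) (hk : 1 ≤ k) (r s : ℝ) (hr : 0 ≤ r) (hrs : r < s) (hs : s ≤ 1) :
    ∃ N : ℕ, ∀ a : ℕ → ℕ → α, ¬ ShatteredByAvg φ r s N (fun _ => k) a := by
  classical
  have hc : 0 < (s - r) / 2 := by linarith
  obtain ⟨N, hN⟩ := exists_mul_pow_lt_pow n k
    (Real.one_lt_exp_iff.2 (show 0 < ((s - r) / 2) ^ 2 / 2 by positivity))
  refine ⟨N, fun a ha => hN.not_ge ?_⟩
  let X : Finset (ℕ × ℕ) := Finset.range N ×ˢ Finset.range k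
  let x : ℕ × ℕ → α := fun p => a p.1 p.2
  let v : Finset (ℕ × ℕ) → ℕ → ℝ := fun A i =>
    ({h : ℕ | h < k ∧ (i, h) ∈ A}.ncard : ℝ) / k - (r + s) / 2
  have hv : ∀ b, ∀ i ∈ Finset.range N,
      v (X.filter fun p => φ (x p) b) i = ave φ k (a i) b - (r + s) / 2 := by
    intro b i hi
    simp only [v, ave]
    congr 4
    ext h
    simp only [Finset.mem_range] at hi
    simp only [X, x, Set.mem_ofPred_eq, Finset.mem_filter, Finset.mem_product, Finset.mem_range]
    tauto
  have hbound := exp_pow_le_card_of_signedSum_ge (Finset.range N) (traceFamily φ x X) v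
    (fun A hA i hi => by
      obtain ⟨-, b, rfl⟩ := Finset.mem_filter.1 hA
      have h0 := ave_nonneg φ k (a i) b
      have h1 := ave_le_one φ k (a i) b
      have hvi := hv b i hi
      rw [abs_le]
      constructor <;> linarith) hc.le
    (fun S _ => by
      obtain ⟨b, hb⟩ := exists_signedSum_ge_of_shatteredByAvg ha S
      refine ⟨X.filter fun p => φ (x p) b,
        Finset.mem_filter.2 ⟨Finset.mem_powerset.2 (Finset.filter_subset _ _), b, rfl⟩, ?_⟩
      rw [Finset.card_range]
      refine hb.trans_eq (Finset.sum_congr rfl fun i hi => ?_)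
      rw [hv b i hi])
  have hcard := card_traceFamily_le hn hVC x X
  rw [Finset.card_range] at hbound
  rw [Finset.card_product, Finset.card_range, Finset.card_range] at hcard
  exact hbound.trans (by exact_mod_cast hcard)
end

section
/- Let α and β be types and φ : α → β → Prop a stable relation, i.e., there exists L ∈ ℕ such that φ has no ladder of length L. Then for all real numbers 0 ≤ r < s ≤ 1, there exists N ∈ ℕ such that there do not exist finite tuples ā_1,…,ā_N of elements of α (of arbitrary lengths ≥ 1) and elements b_1,…,b_N ∈ β with Ave(ā_i)(φ(·,b_j)) ≤ r whenever i < j and Ave(ā_i)(φ(·,b_j)) ≥ s whenever i ≥ j. -/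
/-- `φ` has a ladder of length `L`: there are `a_0,…,a_{L-1}` and `c_0,…,c_{L-1}` such that
`φ (a i) (c j)` holds if and only if `i ≥ j`. -/
def HasLadder {α β : Type*} (φ : α → β → Prop) (L : ℕ) : Prop :=
  ∃ (a : ℕ → α) (c : ℕ → β), ∀ i < L, ∀ j < L, (φ (a i) (c j) ↔ j ≤ i)

open Finset in
/-- A family of sets on `ι` that shatters no set with more than `d` elements has at most
`(card ι + 1) ^ d` members. -/
theorem card_le_of_shatters {ι : Type*} [Fintype ι] [DecidableEq ι] (𝒜 : Finset (Finset ι))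
    (d : ℕ) (h : ∀ s, 𝒜.Shatters s → s.card ≤ d) : 𝒜.card ≤ (Fintype.card ι + 1) ^ d := by
  have hd : 𝒜.vcDim ≤ d := Finset.sup_le fun s hs => h s (mem_shatterer.1 hs)
  calc 𝒜.card ≤ 𝒜.shatterer.card := card_le_card_shatterer 𝒜
    _ ≤ ∑ k ∈ Iic 𝒜.vcDim, (Fintype.card ι).choose k := card_shatterer_le_sum_vcDim
    _ ≤ ∑ k ∈ range (d + 1), (Fintype.card ι).choose k := by
        refine sum_le_sum_of_subset fun k hk => ?_
        simp only [mem_Iic, mem_range] at *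
        omega
    _ ≤ ∑ k ∈ range (d + 1), Fintype.card ι ^ k * 1 ^ (d - k) * d.choose k := by
        refine sum_le_sum fun k hk => ?_
        have h1 : 1 ≤ d.choose k :=
          Nat.choose_pos (Nat.lt_succ_iff.1 (mem_range.1 hk))
        calc _ ≤ Fintype.card ι ^ k := Nat.choose_le_pow _ _
          _ ≤ _ := by simpa using Nat.le_mul_of_pos_right _ h1
    _ = _ := (add_pow _ _ _).symm

theorem HasLadder.mono {α β : Type*} {φ : α → β → Prop} {L L' : ℕ} (hL : L ≤ L')
    (h : HasLadder φ L') : HasLadder φ L := by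
  obtain ⟨a, c, h⟩ := h
  exact ⟨a, c, fun i hi j hj => h i (by omega) j (by omega)⟩

open Classical in
/-- The traces of the instances of `φ` on the family `x`. -/
noncomputable def traces {α β ι : Type*} [Fintype ι] (φ : α → β → Prop) (x : ι → α) :
    Finset (Finset ι) :=
  Finset.univ.filter fun S => ∃ b, ∀ h, h ∈ S ↔ φ (x h) b

open Classical in
theorem hasLadder_of_shatters {α β ι : Type*} [Fintype ι] {φ : α → β → Prop} {x : ι → α}
    {s : Finset ι} (hs : (traces φ x).Shatters s) (hpos : 0 < s.card) :
    HasLadder φ s.card := by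
  let e := s.equivFin
  have key : ∀ j : ℕ, ∃ b, ∀ h ∈ s, (φ (x h) b ↔ ∀ hh : h ∈ s, j ≤ (e ⟨h, hh⟩ : ℕ)) := by
    intro j
    obtain ⟨u, hu, hsu⟩ := hs
      (Finset.filter_subset (fun h => ∀ hh : h ∈ s, j ≤ (e ⟨h, hh⟩ : ℕ)) s)
    obtain ⟨b, hb⟩ := (Finset.mem_filter.1 hu).2
    refine ⟨b, fun h hh => ?_⟩
    have := Finset.ext_iff.1 hsu h
    simp only [Finset.mem_inter, Finset.mem_filter, hh, true_and] at this
    rw [← hb h, this]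
    exact ⟨fun hj _ => hj trivial, fun hj _ => hj hh⟩
  choose c hc using key
  refine ⟨fun i => if hi : i < s.card then x (e.symm ⟨i, hi⟩) else x (e.symm ⟨0, hpos⟩), c,
    fun i hi j _ => ?_⟩
  simp only [hi, dite_true]
  rw [hc j _ (e.symm ⟨i, hi⟩).2]
  simp

theorem card_traces_le {α β ι : Type*} [Fintype ι] {φ : α → β → Prop} {L : ℕ}
    (hL : ¬ HasLadder φ L) (x : ι → α) :
    (traces φ x).card ≤ (Fintype.card ι + 1) ^ L := by
  classical
  refine card_le_of_shatters _ _ fun s hs => ?_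
  by_contra! hlt
  exact hL ((hasLadder_of_shatters (by convert hs) (by omega)).mono hlt.le)

/-- Greedy derandomization of an exponential moment bound for independent sampling. -/
theorem exists_sample_sum_exp_le {ι κ : Type*} [Fintype ι] [Nonempty ι] (A : Finset κ)
    (f : κ → ι → ℝ) (hf : ∀ c ∈ A, ∀ i, |f c i| ≤ 1) (hsum : ∀ c ∈ A, ∑ i, f c i = 0)
    {t : ℝ} (ht0 : 0 ≤ t) (ht1 : t ≤ 1) (m : ℕ) :
    ∃ g : ℕ → ι, ∑ c ∈ A, Real.exp (t * ∑ h ∈ Finset.range m, f c (g h)) ≤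
      A.card * Real.exp (t ^ 2 * m) := by
  induction m with
  | zero => exact ⟨fun _ => Classical.arbitrary ι, by simp⟩
  | succ m ih =>
    obtain ⟨g, hg⟩ := ih
    set w : κ → ℝ := fun c => Real.exp (t * ∑ h ∈ Finset.range m, f c (g h)) with hw
    have hmean : ∀ c ∈ A, ∑ i, Real.exp (t * f c i) ≤ Fintype.card ι * Real.exp (t ^ 2) := by
      intro c hc
      have hpt : ∀ i, Real.exp (t * f c i) ≤ 1 + t * f c i + t ^ 2 := by
        intro i
        have hfi := hf c hc i
        have h1 : |t * f c i| ≤ 1 := by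
          rw [abs_mul, abs_of_nonneg ht0]
          nlinarith [abs_nonneg (f c i)]
        have h2 := (abs_le.1 (Real.abs_exp_sub_one_sub_id_le h1)).2
        have h3 : (f c i) ^ 2 ≤ 1 := (sq_le_one_iff_abs_le_one _).2 hfi
        nlinarith [sq_nonneg t]
      calc ∑ i, Real.exp (t * f c i) ≤ ∑ i, (1 + t * f c i + t ^ 2) :=
            Finset.sum_le_sum fun i _ => hpt i
        _ = Fintype.card ι * (t ^ 2 + 1) := by
            rw [Finset.sum_add_distrib, Finset.sum_add_distrib, ← Finset.mul_sum, hsum c hc]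
            simp
            ring
        _ ≤ _ := by gcongr; exact Real.add_one_le_exp _
    have htot : ∑ i, ∑ c ∈ A, w c * Real.exp (t * f c i) ≤
        ∑ _i : ι, A.card * Real.exp (t ^ 2 * (m + 1 : ℕ)) := by
      rw [Finset.sum_comm]
      calc ∑ c ∈ A, ∑ i, w c * Real.exp (t * f c i)
          ≤ ∑ c ∈ A, w c * (Fintype.card ι * Real.exp (t ^ 2)) := by
            refine Finset.sum_le_sum fun c hc => ?_
            rw [← Finset.mul_sum]
            exact mul_le_mul_of_nonneg_left (hmean c hc) (Real.exp_pos _).le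
        _ = (∑ c ∈ A, w c) * (Fintype.card ι * Real.exp (t ^ 2)) := by rw [Finset.sum_mul]
        _ ≤ (A.card * Real.exp (t ^ 2 * m)) * (Fintype.card ι * Real.exp (t ^ 2)) := by gcongr
        _ = _ := by
            rw [show t ^ 2 * ((m + 1 : ℕ) : ℝ) = t ^ 2 * m + t ^ 2 by push_cast; ring,
              Real.exp_add]
            simp
            ring
    obtain ⟨i, -, hi⟩ := Finset.exists_le_of_sum_le Finset.univ_nonempty htot
    refine ⟨fun h => if h < m then g h else i, le_trans (le_of_eq ?_) hi⟩
    refine Finset.sum_congr rfl fun c _ => ?_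
    rw [Finset.sum_range_succ, mul_add, Real.exp_add, hw]
    simp only [lt_irrefl, if_false]
    congr 3
    exact Finset.sum_congr rfl fun h hh => by rw [if_pos (Finset.mem_range.1 hh)]

open Classical in
theorem ave_eq_sum {α β : Type*} (φ : α → β → Prop) (k : ℕ) (a : ℕ → α) (b : β) :
    ave φ k a b = (∑ h ∈ Finset.range k, if φ (a h) b then (1 : ℝ) else 0) / k := by
  have : {h : ℕ | h < k ∧ φ (a h) b} = ↑((Finset.range k).filter fun h => φ (a h) b) := by
    ext; simp
  rw [ave, this, Set.ncard_coe_finset, Finset.sum_boole]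

/-- A uniform law of large numbers: a tuple of length `k` can be replaced by one of length `m`
with an error of at most `δ` in the averages of all instances of `φ`. -/
theorem exists_ave_approx {α β : Type*} {φ : α → β → Prop} {L : ℕ} (hL : ¬ HasLadder φ L)
    {k : ℕ} (hk : 1 ≤ k) (a : ℕ → α) {m : ℕ} (hm : 1 ≤ m) {δ : ℝ} (hδ0 : 0 < δ) (hδ1 : δ ≤ 1)
    (hlt : 2 * ((k : ℝ) + 1) ^ L < Real.exp (δ ^ 2 * m / 4)) :
    ∃ y : ℕ → α, ∀ b, |ave φ m y b - ave φ k a b| ≤ δ := by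
  classical
  have : Nonempty (Fin k) := ⟨⟨0, hk⟩⟩
  have hk0 : (0 : ℝ) < k := by exact_mod_cast hk
  have hm0 : (0 : ℝ) < m := by exact_mod_cast hm
  set x : Fin k → α := fun h => a h with hx
  let ind : Finset (Fin k) → Fin k → ℝ := fun S i => if i ∈ S then 1 else 0
  let mu : Finset (Fin k) → ℝ := fun S => (∑ i, ind S i) / k
  have hind0 : ∀ S i, 0 ≤ ind S i := fun S i => by simp only [ind]; split_ifs <;> norm_num
  have hind1 : ∀ S i, ind S i ≤ 1 := fun S i => by simp only [ind]; split_ifs <;> norm_num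
  have hmu0 : ∀ S, 0 ≤ mu S := fun S =>
    div_nonneg (Finset.sum_nonneg fun i _ => hind0 S i) hk0.le
  have hmu1 : ∀ S, mu S ≤ 1 := fun S => by
    rw [div_le_one hk0]
    simpa using Finset.sum_le_sum fun i (_ : i ∈ Finset.univ) => hind1 S i
  have habs : ∀ S i, |ind S i - mu S| ≤ 1 := fun S i =>
    abs_le.2 ⟨by linarith [hind0 S i, hmu1 S], by linarith [hind1 S i, hmu0 S]⟩
  have hmean : ∀ S, ∑ i, (ind S i - mu S) = 0 := fun S => by
    rw [Finset.sum_sub_distrib]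
    simp [mu]
    field_simp
    simp
  let f : Finset (Fin k) × Bool → Fin k → ℝ := fun c i =>
    (if c.2 then 1 else -1) * (ind c.1 i - mu c.1)
  obtain ⟨g, hg⟩ := exists_sample_sum_exp_le (traces φ x ×ˢ Finset.univ) f
    (fun c _ i => by
      have := habs c.1 i
      rcases c with ⟨S, _ | _⟩ <;> simpa [f, abs_sub_comm] using this)
    (fun c _ => by simp only [f]; rw [← Finset.mul_sum, hmean, mul_zero])
    (t := δ / 2) (by linarith) (by linarith) m
  have hcard : (((traces φ x ×ˢ (Finset.univ : Finset Bool)).card : ℕ) : ℝ) ≤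
      2 * ((k : ℝ) + 1) ^ L := by
    have h := card_traces_le hL x
    rw [Fintype.card_fin] at h
    rw [Finset.card_product, Finset.card_univ, Fintype.card_bool, Nat.cast_mul, mul_comm]
    have : (((traces φ x).card : ℕ) : ℝ) ≤ ((k : ℝ) + 1) ^ L := by exact_mod_cast h
    push_cast
    linarith
  have hbound : ∀ c ∈ traces φ x ×ˢ (Finset.univ : Finset Bool),
      ∑ h ∈ Finset.range m, f c (g h) ≤ δ * m := by
    intro c hc
    have h1 := (Finset.single_le_sum (f := fun c =>
      Real.exp (δ / 2 * ∑ h ∈ Finset.range m, f c (g h)))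
      (fun c _ => (Real.exp_pos _).le) hc).trans hg
    have h2 : Real.exp (δ / 2 * ∑ h ∈ Finset.range m, f c (g h)) <
        Real.exp (δ ^ 2 * m / 4) * Real.exp ((δ / 2) ^ 2 * m) :=
      h1.trans_lt (mul_lt_mul_of_pos_right (hcard.trans_lt hlt) (Real.exp_pos _))
    rw [← Real.exp_add, Real.exp_lt_exp] at h2
    have h3 : δ / 2 * ∑ h ∈ Finset.range m, f c (g h) ≤ δ / 2 * (δ * m) := by
      refine h2.le.trans (le_of_eq ?_)
      ring
    exact le_of_mul_le_mul_left h3 (by linarith)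
  refine ⟨fun h => x (g h), fun b => ?_⟩
  let S : Finset (Fin k) := Finset.univ.filter fun h => φ (x h) b
  have hS : S ∈ traces φ x := Finset.mem_filter.2 ⟨Finset.mem_univ _, b, fun h => by simp [S]⟩
  have hmuS : ave φ k a b = mu S := by
    rw [ave_eq_sum, Finset.sum_range]
    simp [mu, ind, S, hx]
  have haveS : ave φ m (fun h => x (g h)) b - mu S =
      (∑ h ∈ Finset.range m, (ind S (g h) - mu S)) / m := by
    rw [ave_eq_sum, Finset.sum_sub_distrib, Finset.sum_const, Finset.card_range, nsmul_eq_mul,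
      sub_div, mul_div_cancel_left₀ _ hm0.ne']
    simp [ind, S]
  rw [hmuS, haveS, abs_div, abs_of_pos hm0, div_le_iff₀ hm0, abs_le]
  have hp := hbound (S, true) (by simp [hS])
  have hn := hbound (S, false) (by simp [hS])
  simp only [f, if_true, one_mul, Bool.false_eq_true, if_false, ← Finset.mul_sum] at hp hn
  exact ⟨by linarith, hp⟩

open Filter Topology in
/-- The sampling condition holds for samples of length `2 ^ p` with error `(3 / 4) ^ p`, even when
the tuple sampled from has length up to `C * 2 ^ p`. -/
theorem eventually_sample_size (L : ℕ) (C : ℝ) (hC : 1 ≤ C) :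
    ∀ᶠ p : ℕ in atTop, 2 * (C * 2 ^ p + 1) ^ L <
      Real.exp ((((3 : ℝ) / 4) ^ p) ^ 2 * ((2 ^ p : ℕ) : ℝ) / 4) := by
  have hlim : Tendsto (fun p : ℕ => ((p : ℝ) ^ 1) / ((9 : ℝ) / 8) ^ p) atTop (𝓝 0) :=
    tendsto_pow_const_div_const_pow_of_one_lt 1 (by norm_num)
  have hlim2 : Tendsto (fun p : ℕ => ((9 : ℝ) / 8) ^ p) atTop atTop :=
    tendsto_pow_atTop_atTop_of_one_lt (by norm_num)
  set K : ℝ := 2 + L * (C + 1) with hK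
  have hKpos : 0 < K := by positivity
  have hev := hlim.eventually (gt_mem_nhds (show (0 : ℝ) < 1 / (8 * (L + 1)) by positivity))
  filter_upwards [hev, hlim2.eventually_gt_atTop (8 * K)] with p hp1 hp2
  have hq : (((3 : ℝ) / 4) ^ p) ^ 2 * ((2 ^ p : ℕ) : ℝ) / 4 = ((9 : ℝ) / 8) ^ p / 4 := by
    push_cast
    rw [← pow_mul, mul_comm p 2, pow_mul, ← mul_pow]
    norm_num
  rw [hq]
  have hpos : (0 : ℝ) < (9 / 8) ^ p := by positivity
  rw [pow_one, div_lt_div_iff₀ hpos (by positivity)] at hp1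
  have h2 : (2 : ℝ) ≤ Real.exp 1 := by linarith [Real.add_one_le_exp (1 : ℝ)]
  have hone : (1 : ℝ) ≤ 2 ^ p := one_le_pow₀ (by norm_num)
  have hbase : C * 2 ^ p + 1 ≤ Real.exp (C + p) := by
    calc C * 2 ^ p + 1 ≤ (C + 1) * 2 ^ p := by linarith
      _ ≤ Real.exp C * Real.exp 1 ^ p := by gcongr; exact Real.add_one_le_exp C
      _ = _ := by rw [Real.exp_add, ← Real.exp_nat_mul, mul_one]
  calc 2 * (C * 2 ^ p + 1) ^ L ≤ Real.exp 1 * Real.exp (C + p) ^ L := by gcongr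
    _ = Real.exp (1 + L * (C + p)) := by
      rw [← Real.exp_nat_mul, ← Real.exp_add]
    _ < _ := by
      rw [Real.exp_lt_exp]
      have : (0 : ℝ) ≤ L := Nat.cast_nonneg L
      have hpn : (0 : ℝ) ≤ p := Nat.cast_nonneg p
      nlinarith

/-- Every tuple is approximated by one of a length that does not depend on the tuple. -/
theorem exists_uniform_ave_approx {α β : Type*} {φ : α → β → Prop} {L : ℕ}
    (hL : ¬ HasLadder φ L) {ε : ℝ} (hε : 0 < ε) :
    ∃ m : ℕ, 1 ≤ m ∧ ∀ k : ℕ, 1 ≤ k → ∀ a : ℕ → α,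
      ∃ y : ℕ → α, ∀ b, |ave φ m y b - ave φ k a b| ≤ ε := by
  obtain ⟨q, hq⟩ := Filter.eventually_atTop.1 (eventually_sample_size L 2 (by norm_num))
  obtain ⟨q', hq'⟩ := exists_pow_lt_of_lt_one (show 0 < ε / 5 by linarith)
    (show (3 / 4 : ℝ) < 1 by norm_num)
  set p₀ := max q q' with hp₀
  have hp₀ε : (3 / 4 : ℝ) ^ p₀ ≤ ε / 5 :=
    (pow_le_pow_of_le_one (by norm_num) (by norm_num) (le_max_right q q')).trans hq'.le
  have hpow1 : ∀ p : ℕ, (3 / 4 : ℝ) ^ p ≤ 1 := fun p => pow_le_one₀ (by norm_num) (by norm_num)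
  have chain : ∀ p, p₀ ≤ p → ∀ a : ℕ → α, ∃ y : ℕ → α, ∀ b,
      |ave φ (2 ^ p₀) y b - ave φ (2 ^ p) a b| ≤ 4 * (3 / 4) ^ p₀ - 4 * (3 / 4) ^ p := by
    intro p hp
    induction p, hp using Nat.le_induction with
    | base => exact fun a => ⟨a, fun b => by simp⟩
    | succ p hp ih =>
      intro a
      obtain ⟨z, hz⟩ := exists_ave_approx hL (k := 2 ^ (p + 1)) Nat.one_le_two_pow a
        (m := 2 ^ p) Nat.one_le_two_pow (δ := (3 / 4) ^ p) (by positivity) (hpow1 p) (by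
          have := hq p (le_trans (le_max_left _ _) hp)
          convert this using 4
          push_cast
          ring)
      obtain ⟨y, hy⟩ := ih z
      refine ⟨y, fun b => ?_⟩
      have h1 := abs_le.1 (hy b)
      have h2 := abs_le.1 (hz b)
      rw [abs_le, pow_succ]
      constructor <;> linarith
  refine ⟨2 ^ p₀, Nat.one_le_two_pow, fun k hk a => ?_⟩
  obtain ⟨p, hp, hpp⟩ := ((eventually_sample_size L k (by exact_mod_cast hk)).and
    (Filter.eventually_ge_atTop p₀)).exists
  obtain ⟨z, hz⟩ := exists_ave_approx hL hk a (m := 2 ^ p) Nat.one_le_two_pow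
    (δ := (3 / 4) ^ p) (by positivity) (hpow1 p) (by
      refine lt_of_le_of_lt ?_ hp
      have : (1 : ℝ) ≤ 2 ^ p := one_le_pow₀ (by norm_num)
      have hk0 : (0 : ℝ) ≤ k := Nat.cast_nonneg k
      gcongr
      nlinarith)
  obtain ⟨y, hy⟩ := chain p hpp z
  refine ⟨y, fun b => ?_⟩
  have h1 := abs_le.1 (hy b)
  have h2 := abs_le.1 (hz b)
  have h3 : (0 : ℝ) < (3 / 4) ^ p := by positivity
  rw [abs_le]
  constructor <;> linarith

/-- Every large set of naturals contains an increasing sequence along which the colour of a pair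
depends only on its smaller element. -/
theorem exists_prehomogeneous (C : Type*) [Fintype C] [Nonempty C] (n : ℕ) :
    ∃ N : ℕ, ∀ (col : ℕ → ℕ → C) (A : Finset ℕ), N ≤ A.card →
      ∃ (e : ℕ → ℕ) (c : ℕ → C), (∀ i < n, e i ∈ A) ∧
        ∀ i j, i < j → j < n → e i < e j ∧ col (e i) (e j) = c i := by
  classical
  induction n with
  | zero => exact ⟨0, fun _ _ _ => ⟨id, fun _ => Classical.arbitrary C, by simp, by simp⟩⟩
  | succ n ih =>
    obtain ⟨N, hN⟩ := ih
    refine ⟨Fintype.card C * N + 1, fun col A hA => ?_⟩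
    have hne : A.Nonempty := Finset.card_pos.1 (by omega)
    set a := A.min' hne
    have hcard : (Finset.univ : Finset C).card * N ≤ (A.erase a).card := by
      rw [Finset.card_erase_of_mem (A.min'_mem hne), Finset.card_univ]
      omega
    obtain ⟨c₀, -, hc₀⟩ := Finset.exists_le_card_fiber_of_mul_le_card_of_maps_to
      (f := col a) (fun x _ => Finset.mem_univ _) Finset.univ_nonempty hcard
    obtain ⟨e, c, he, hec⟩ := hN col _ hc₀
    refine ⟨fun i => Nat.casesOn i a e, fun i => Nat.casesOn i c₀ c, ?_, ?_⟩
    · rintro (_ | i) hi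
      · exact A.min'_mem hne
      · exact Finset.mem_of_mem_erase (Finset.mem_filter.1 (he i (by omega))).1
    · rintro (_ | i) (_ | j) hij hj
      · omega
      · have hm := Finset.mem_filter.1 (he j (by omega))
        exact ⟨A.min'_lt_of_mem_erase_min' hne hm.1, hm.2⟩
      · omega
      · exact hec i j (by omega) (by omega)

/-- The finite Ramsey theorem for pairs. -/
theorem exists_homogeneous (C : Type*) [Fintype C] [Nonempty C] (n : ℕ) :
    ∃ N : ℕ, ∀ col : ℕ → ℕ → C, ∃ (e : Fin n → ℕ) (c : C), (∀ i, e i < N) ∧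
      ∀ i j, i < j → e i < e j ∧ col (e i) (e j) = c := by
  classical
  obtain ⟨N, hN⟩ := exists_prehomogeneous C (Fintype.card C * n)
  refine ⟨N, fun col => ?_⟩
  obtain ⟨e, c, he, hec⟩ := hN col (Finset.range N) (by simp)
  obtain ⟨c₀, -, hc₀⟩ := Finset.exists_le_card_fiber_of_mul_le_card_of_maps_to
    (s := Finset.range (Fintype.card C * n)) (n := n) (f := c)
    (fun x _ => Finset.mem_univ _) Finset.univ_nonempty (by simp)
  set o := Finset.orderEmbOfCardLe _ hc₀
  have ho : ∀ i, o i < Fintype.card C * n ∧ c (o i) = c₀ := fun i => by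
    simpa using Finset.mem_filter.1 (Finset.orderEmbOfCardLe_mem _ hc₀ i)
  refine ⟨fun i => e (o i), c₀, fun i => Finset.mem_range.1 (he _ (ho i).1), fun i j hij => ?_⟩
  have h := hec (o i) (o j) (o.lt_iff_lt.2 hij) (ho j).1
  exact ⟨h.1, h.2.trans (ho i).2⟩

theorem exists_of_ave_lt {α β : Type*} {φ : α → β → Prop} {m : ℕ} {y z : ℕ → α} {b c : β}
    (h : ave φ m y b < ave φ m z c) : ∃ h < m, ¬ φ (y h) b ∧ φ (z h) c := by
  classical
  by_contra! hcon
  refine h.not_ge ?_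
  rw [ave_eq_sum, ave_eq_sum]
  gcongr with i hi
  have := hcon i (Finset.mem_range.1 hi)
  by_cases h1 : φ (y i) b <;> by_cases h2 : φ (z i) c <;> simp_all

theorem stmt12 {α β : Type*} (φ : α → β → Prop)
    (hstable : ∃ L : ℕ, ¬ HasLadder φ L)
    (r s : ℝ) (hr : 0 ≤ r) (hrs : r < s) (hs : s ≤ 1) :
    ∃ N : ℕ, ¬ ∃ (k : ℕ → ℕ) (a : ℕ → ℕ → α) (b : ℕ → β),
      (∀ i < N, 1 ≤ k i) ∧
      (∀ i < N, ∀ j < N,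
        (i < j → ave φ (k i) (a i) (b j) ≤ r) ∧
        (j ≤ i → s ≤ ave φ (k i) (a i) (b j))) := by
  obtain ⟨L, hL⟩ := hstable
  obtain ⟨m, hm, happ⟩ := exists_uniform_ave_approx hL (show 0 < (s - r) / 3 by linarith)
  have : Nonempty (Fin m) := ⟨⟨0, hm⟩⟩
  obtain ⟨N, hN⟩ := exists_homogeneous (Fin m) (2 * L)
  refine ⟨N, ?_⟩
  rintro ⟨k, a, b, hk, hab⟩
  have happ' : ∀ i, ∃ y : ℕ → α, i < N → ∀ b,
      |ave φ m y b - ave φ (k i) (a i) b| ≤ (s - r) / 3 := fun i => by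
    by_cases hi : i < N
    · obtain ⟨y, hy⟩ := happ (k i) (hk i hi) (a i)
      exact ⟨y, fun _ => hy⟩
    · exact ⟨a i, fun h => absurd h hi⟩
  choose y hy using happ'
  have hcol : ∀ i j, ∃ h : Fin m, i < j → j < N → ¬ φ (y i h) (b j) ∧ φ (y j h) (b i) := by
    intro i j
    by_cases hij : i < j ∧ j < N
    · obtain ⟨hij, hj⟩ := hij
      have hi := hij.trans hj
      have h1 := (hab i hi j hj).1 hij
      have h2 := (hab j hj i hi).2 hij.le
      have h3 := abs_le.1 (hy i hi (b j))
      have h4 := abs_le.1 (hy j hj (b i))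
      obtain ⟨h, hhm, hh⟩ := exists_of_ave_lt (φ := φ) (m := m) (y := y i) (z := y j) (b := b j)
        (c := b i) (by linarith)
      exact ⟨⟨h, hhm⟩, fun _ _ => hh⟩
    · exact ⟨Classical.arbitrary _, fun h h' => absurd ⟨h, h'⟩ hij⟩
  choose col hcol using hcol
  obtain ⟨e, h, heN, he⟩ := hN col
  have hpair : ∀ i j, i < j → ¬ φ (y (e i) h) (b (e j)) ∧ φ (y (e j) h) (b (e i)) := by
    intro i j hij
    have h1 := he i j hij
    have h2 := hcol (e i) (e j) h1.1 (heN j)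
    rwa [h1.2] at h2
  refine hL ⟨fun i => y (if hi : 2 * i + 1 < 2 * L then e ⟨2 * i + 1, hi⟩ else 0) h,
    fun j => b (if hj : 2 * j < 2 * L then e ⟨2 * j, hj⟩ else 0), fun i hi j hj => ?_⟩
  have hi' : 2 * i + 1 < 2 * L := by omega
  have hj' : 2 * j < 2 * L := by omega
  simp only [hi', hj', dite_true]
  constructor
  · intro hφ
    by_contra! hlt
    exact (hpair ⟨2 * i + 1, hi'⟩ ⟨2 * j, hj'⟩ (Fin.mk_lt_mk.2 (by omega))).1 hφ
  · intro hle
    exact (hpair ⟨2 * j, hj'⟩ ⟨2 * i + 1, hi'⟩ (Fin.mk_lt_mk.2 (by omega))).2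
end

section
/- Let α and β be types, φ : α → β → Prop a relation, m, k ∈ ℕ with m, k ≥ 1, and 0 ≤ r < s ≤ 1 real numbers. Let (a_{i,l}) (1 ≤ i ≤ m, 1 ≤ l ≤ k) be an (m,k)-array of elements of α that is strongly φ-k-m-indiscernible, and write ā_i = (a_{i,1},…,a_{i,k}). Suppose there exist b_1,…,b_m ∈ β such that Ave(ā_i)(φ(·,b_j)) ≤ r whenever i < j and Ave(ā_i)(φ(·,b_j)) ≥ s whenever i ≥ j. Then there exist c_1,…,c_m ∈ β such that φ(a_{i,1}, c_j) holds if and only if i ≥ j; in particular, φ has a ladder of length m. -/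
/-- An `(m,k)`-array `a` (rows `i < m`, columns `l < k`) is strongly
`φ`-`k`-`n`-indiscernible. -/
def StrongArrayIndisc {α β : Type*} (φ : α → β → Prop) (n k m : ℕ) (a : ℕ → ℕ → α) : Prop :=
  ∀ u v f : Fin n → ℕ, StrictMono u → StrictMono v →
    (∀ l, u l < m) → (∀ l, v l < m) → (∀ l, f l < k) →
    phiType φ (fun l => a (u l) 0) = phiType φ (fun l => a (v l) (f l))

theorem exists_of_ave_pos {α β : Type*} {φ : α → β → Prop} {k : ℕ} {aa : ℕ → α} {b : β}
    (h : 0 < ave φ k aa b) : ∃ l < k, φ (aa l) b := by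
  by_contra! hn
  have he : {l : ℕ | l < k ∧ φ (aa l) b} = ∅ :=
    Set.eq_empty_of_forall_notMem fun l hl => hn l hl.1 hl.2
  simp [ave, he] at h

theorem exists_not_of_ave_lt_one {α β : Type*} {φ : α → β → Prop} {k : ℕ} {aa : ℕ → α} {b : β}
    (hk : 1 ≤ k) (h : ave φ k aa b < 1) : ∃ l < k, ¬ φ (aa l) b := by
  by_contra! hn
  have he : {l : ℕ | l < k ∧ φ (aa l) b} = Set.Iio k :=
    Set.ext fun l => ⟨fun hl => hl.1, fun hl => ⟨hl, hn l hl⟩⟩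
  have hk0 : (k : ℝ) ≠ 0 := by exact_mod_cast (by omega : k ≠ 0)
  have hcard : (Set.Iio k).ncard = k := by
    rw [← Finset.coe_Iio, Set.ncard_coe_finset, Nat.card_Iio]
  rw [ave, he, hcard, div_self hk0] at h
  exact lt_irrefl _ h

theorem stmt14 {α β : Type*} (φ : α → β → Prop) (m k : ℕ) (hm : 1 ≤ m) (hk : 1 ≤ k)
    (r s : ℝ) (hr : 0 ≤ r) (hrs : r < s) (hs : s ≤ 1)
    (a : ℕ → ℕ → α) (hind : StrongArrayIndisc φ m k m a)
    (b : ℕ → β)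
    (hb : ∀ i < m, ∀ j < m,
      (i < j → ave φ k (a i) (b j) ≤ r) ∧ (j ≤ i → s ≤ ave φ k (a i) (b j))) :
    (∃ c : ℕ → β, ∀ i < m, ∀ j < m, (φ (a i 0) (c j) ↔ j ≤ i)) ∧ HasLadder φ m := by
  have key : ∀ j, ∃ c : β, j < m → ∀ i < m, (φ (a i 0) c ↔ j ≤ i) := by
    intro j
    by_cases hj : j < m
    · have hcol : ∀ i : Fin m, ∃ l < k, (φ (a i l) (b j) ↔ j ≤ (i : ℕ)) := by
        intro i
        obtain ⟨hlo, hhi⟩ := hb i i.2 j hj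
        rcases lt_or_ge (i : ℕ) j with hij | hij
        · obtain ⟨l, hl, hn⟩ := exists_not_of_ave_lt_one hk
            ((hlo hij).trans_lt (hrs.trans_le hs))
          exact ⟨l, hl, iff_of_false hn hij.not_ge⟩
        · obtain ⟨l, hl, hp⟩ := exists_of_ave_pos ((hr.trans_lt hrs).trans_le (hhi hij))
          exact ⟨l, hl, iff_of_true hp hij⟩
      choose f hfk hf using hcol
      have hmem : {i : Fin m | j ≤ (i : ℕ)} ∈ phiType φ (fun i : Fin m => a i (f i)) :=
        ⟨b j, hf⟩
      rw [← hind (fun i => i) (fun i => i) f Fin.val_strictMono Fin.val_strictMono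
        Fin.is_lt Fin.is_lt hfk] at hmem
      obtain ⟨c, hc⟩ := hmem
      exact ⟨c, fun _ i hi => hc ⟨i, hi⟩⟩
    · exact ⟨b j, fun h => absurd h hj⟩
  choose c hc using key
  have hladder : ∀ i < m, ∀ j < m, (φ (a i 0) (c j) ↔ j ≤ i) := fun i hi j hj => hc j hj i hi
  exact ⟨⟨c, hladder⟩, fun i => a i 0, c, hladder⟩
end
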